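/- For every n ≥ 4, there exists a connected simple graph G on n vertices that is gap-vertex-labelable and satisfies C(n,2) − |E(G)| ≤ 3·n^{3/2}. Equivalently, the gap-strength of the complete graph K_n — the least number l of edges whose removal from K_n can yield a gap-vertex-labelable graph — satisfies str_gap(K_n) ≤ 3·n^{3/2}, so str_gap(K_n) ∈ O(n^{3/2}). -/

import Mathlib

/-- The neighbourhood of `v` in `G` as a `Finset` (classically decidable). -/
noncomputable def gapNbhd {V : Type*} [Fintype V] (G : SimpleGraph V) (v : V) : Finset V :=
  @Finset.filter V (fun u => G.Adj v u) (Classical.decPred _) Finset.univ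

/-- The colouring induced by a vertex-labelling `π` : a vertex with at least two neighbours
gets the gap `max − min` of the labels of its neighbours, a vertex with exactly one neighbour
`u` gets `π u`, and an isolated vertex gets `1`. -/
noncomputable def gapColor {V : Type*} [Fintype V] (G : SimpleGraph V) (π : V → ℕ) (v : V) : ℕ :=
  if h : ((gapNbhd G v).image π).Nonempty then
    if 2 ≤ (gapNbhd G v).card then
      ((gapNbhd G v).image π).max' h - ((gapNbhd G v).image π).min' h
    else ((gapNbhd G v).image π).max' h
  else 1

/-- `π` is a gap-`[k]`-vertex-labelling of `G`: the labels lie in `{1, …, k}` and the induced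
colouring is proper. -/
def IsGapLabelling {V : Type*} [Fintype V] (G : SimpleGraph V) (k : ℕ) (π : V → ℕ) : Prop :=
  (∀ v, 1 ≤ π v ∧ π v ≤ k) ∧
  ∀ u v, G.Adj u v → gapColor G π u ≠ gapColor G π v

/-- `G` is gap-vertex-labelable if it admits a gap-`[k]`-vertex-labelling for some `k ≥ 1`. -/
def GapVertexLabelable {V : Type*} [Fintype V] (G : SimpleGraph V) : Prop :=
  ∃ k, 1 ≤ k ∧ ∃ π, IsGapLabelling G k π

/-- The vertex-gap number: the least `k ≥ 1` for which `G` admits a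
gap-`[k]`-vertex-labelling. -/
noncomputable def vertexGapNumber {V : Type*} [Fintype V] (G : SimpleGraph V) : ℕ :=
  sInf {k | 1 ≤ k ∧ ∃ π, IsGapLabelling G k π}

theorem mem_gapNbhd {V : Type*} [Fintype V] {G : SimpleGraph V} {u v : V} :
    u ∈ gapNbhd G v ↔ G.Adj v u := by
  simp [gapNbhd]

/-- A vertex whose neighbours all have label at most `1` gets colour at most `1`. -/
theorem gapColor_le_one {V : Type*} [Fintype V] {G : SimpleGraph V} {π : V → ℕ} {v : V}
    (h : ∀ u, G.Adj v u → π u ≤ 1) : gapColor G π v ≤ 1 := by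
  unfold gapColor
  split_ifs with hne hcard
  · refine (Nat.sub_le _ _).trans (Finset.max'_le _ _ _ fun y hy => ?_)
    obtain ⟨u, hu, rfl⟩ := Finset.mem_image.1 hy
    exact h u (mem_gapNbhd.1 hu)
  · refine Finset.max'_le _ _ _ fun y hy => ?_
    obtain ⟨u, hu, rfl⟩ := Finset.mem_image.1 hy
    exact h u (mem_gapNbhd.1 hu)
  · exact le_rfl

/-- The colour of a vertex whose neighbours have smallest label `π b` and largest label `π a`,
these two labels being distinct. -/
theorem gapColor_eq_sub {V : Type*} [Fintype V] {G : SimpleGraph V} {π : V → ℕ} {v a b : V}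
    (ha : G.Adj v a) (hb : G.Adj v b) (hlt : π b < π a)
    (h : ∀ u, G.Adj v u → π b ≤ π u ∧ π u ≤ π a) : gapColor G π v = π a - π b := by
  have ha' : π a ∈ (gapNbhd G v).image π := Finset.mem_image_of_mem _ (mem_gapNbhd.2 ha)
  have hb' : π b ∈ (gapNbhd G v).image π := Finset.mem_image_of_mem _ (mem_gapNbhd.2 hb)
  have hcard : 2 ≤ (gapNbhd G v).card := Finset.one_lt_card.2
    ⟨a, mem_gapNbhd.2 ha, b, mem_gapNbhd.2 hb, fun hab => by simp [hab] at hlt⟩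
  rw [gapColor, dif_pos ⟨_, ha'⟩, if_pos hcard]
  congr 1
  · refine le_antisymm (Finset.max'_le _ _ _ fun y hy => ?_) (Finset.le_max' _ _ ha')
    obtain ⟨u, hu, rfl⟩ := Finset.mem_image.1 hy
    exact (h u (mem_gapNbhd.1 hu)).2
  · refine le_antisymm (Finset.min'_le _ _ hb') (Finset.le_min' _ _ _ fun y hy => ?_)
    obtain ⟨u, hu, rfl⟩ := Finset.mem_image.1 hy
    exact (h u (mem_gapNbhd.1 hu)).1

/-- The vertices `v ≥ s` form a complete multipartite graph whose parts are the residue classes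
modulo `s`; the vertices `u < s` are independent, and `u` is joined to the parts of residue at
least `u`. -/
def residueGraph (n s : ℕ) : SimpleGraph (Fin n) where
  Adj u v := (s ≤ u.1 ∧ s ≤ v.1 ∧ u.1 % s ≠ v.1 % s) ∨ (u.1 < s ∧ s ≤ v.1 ∧ u.1 ≤ v.1 % s) ∨
    (v.1 < s ∧ s ≤ u.1 ∧ v.1 ≤ u.1 % s)
  symm := ⟨fun u v h => by
    rcases h with h | h | h
    · exact Or.inl ⟨h.2.1, h.1, h.2.2.symm⟩
    · exact Or.inr (Or.inr h)
    · exact Or.inr (Or.inl h)⟩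
  loopless := ⟨fun u h => by
    rcases h with h | h | h
    · exact h.2.2 rfl
    · omega
    · omega⟩

theorem residueGraph_adj {n s : ℕ} {u v : Fin n} : (residueGraph n s).Adj u v ↔
    (s ≤ u.1 ∧ s ≤ v.1 ∧ u.1 % s ≠ v.1 % s) ∨ (u.1 < s ∧ s ≤ v.1 ∧ u.1 ≤ v.1 % s) ∨
      (v.1 < s ∧ s ≤ u.1 ∧ v.1 ≤ u.1 % s) :=
  Iff.rfl

theorem residueGraph_connected {n s : ℕ} (hs : 2 ≤ s) (hn : 2 * s ≤ n) :
    (residueGraph n s).Connected := by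
  have reach_large (v : Fin n) (hv : s ≤ v.1) :
      (residueGraph n s).Reachable ⟨0, by omega⟩ v :=
    SimpleGraph.Adj.reachable <|
      residueGraph_adj.2 (Or.inr (Or.inl ⟨by simp; omega, hv, Nat.zero_le _⟩))
  rw [SimpleGraph.connected_iff_exists_forall_reachable]
  refine ⟨⟨0, by omega⟩, fun v => ?_⟩
  rcases le_or_gt s v.1 with hv | hv
  · exact reach_large v hv
  · refine (reach_large ⟨s + (s - 1), by omega⟩ (by simp)).trans (SimpleGraph.Adj.reachable ?_)
    refine residueGraph_adj.2 (Or.inr (Or.inr ⟨hv, by simp, ?_⟩))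
    rw [Nat.add_mod_left, Nat.mod_eq_of_lt (by omega)]
    omega

theorem residueGraph_gapVertexLabelable {n s : ℕ} (hs : 2 ≤ s) (hn : 2 * s ≤ n) :
    GapVertexLabelable (residueGraph n s) := by
  let π : Fin n → ℕ := fun v => if v.1 < s then v.1 + 3 else 1
  have pi_small (v : Fin n) (hv : v.1 < s) : π v = v.1 + 3 := if_pos hv
  have pi_large (v : Fin n) (hv : s ≤ v.1) : π v = 1 := if_neg (by omega)
  have color_small (v : Fin n) (hv : v.1 < s) : gapColor (residueGraph n s) π v ≤ 1 := by
    refine gapColor_le_one fun u hu => (pi_large u ?_).le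
    rw [residueGraph_adj] at hu
    omega
  have color_large (v : Fin n) (hv : s ≤ v.1) :
      gapColor (residueGraph n s) π v = v.1 % s + 2 := by
    have hmod : v.1 % s < s := Nat.mod_lt _ (by omega)
    obtain ⟨r, hr, hrv⟩ : ∃ r < s, v.1 % s ≠ r := by
      by_cases h : v.1 % s = 0
      · exact ⟨1, by omega, by omega⟩
      · exact ⟨0, by omega, h⟩
    let a : Fin n := ⟨v.1 % s, by omega⟩
    let b : Fin n := ⟨s + r, by omega⟩
    have ha : π a = v.1 % s + 3 := pi_small a hmod
    have hb : π b = 1 := pi_large b (Nat.le_add_right _ _)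
    have hva : (residueGraph n s).Adj v a :=
      residueGraph_adj.2 (Or.inr (Or.inr ⟨hmod, hv, le_rfl⟩))
    have hvb : (residueGraph n s).Adj v b := by
      refine residueGraph_adj.2 (Or.inl ⟨hv, Nat.le_add_right _ _, ?_⟩)
      rwa [Nat.add_mod_left, Nat.mod_eq_of_lt hr]
    rw [gapColor_eq_sub hva hvb (by omega) fun u hu => ?_]
    · omega
    · rw [residueGraph_adj] at hu
      rcases le_or_gt s u.1 with h | h
      · rw [pi_large u h]; omega
      · rw [pi_small u h]; omega
  refine ⟨s + 3, by omega, π, fun v => ?_, fun u v huv => ?_⟩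
  · rcases le_or_gt s v.1 with h | h
    · rw [pi_large v h]; omega
    · rw [pi_small v h]; omega
  · rw [residueGraph_adj] at huv
    rcases huv with ⟨hu, hv, huv⟩ | ⟨hu, hv, -⟩ | ⟨hv, hu, -⟩
    · rw [color_large u hu, color_large v hv]; omega
    · have := color_small u hu
      rw [color_large v hv]; omega
    · have := color_small v hv
      rw [color_large u hu]; omega

theorem residueGraph_compl_edgeSet_ncard_le {n s : ℕ} (hs : 0 < s) (hn : n ≤ s * (s + 2)) :
    (residueGraph n s)ᶜ.edgeSet.ncard ≤ n * (2 * s + 1) := by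
  let P : Set (Fin n × Fin n) := {p | p.1 < p.2 ∧ ¬ (residueGraph n s).Adj p.1 p.2}
  -- Given the larger vertex `v`, the smaller one `u` is determined by `u` if `u < s`, and by
  -- `u / s` otherwise, since then `u` and `v` agree modulo `s`.
  let code : ℕ → ℕ := fun u => if u < s then u else s - 1 + u / s
  have code_lt (u : Fin n) : code u.1 < 2 * s + 1 := by
    have : u.1 / s < s + 2 := Nat.div_lt_of_lt_mul (u.2.trans_le hn)
    simp only [code]
    split_ifs <;> omega
  have hP : P.ncard ≤ n * (2 * s + 1) := by
    have hcard : (Set.univ : Set (Fin n × Fin (2 * s + 1))).ncard = n * (2 * s + 1) := by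
      simp [Set.ncard_univ]
    rw [← hcard]
    refine Set.ncard_le_ncard_of_injOn (fun p => (p.2, ⟨code p.1.1, code_lt p.1⟩))
      (fun _ _ => Set.mem_univ _) ?_
    rintro ⟨u, v⟩ ⟨huv, hu⟩ ⟨u', v'⟩ ⟨huv', hu'⟩ h
    simp only [Prod.mk.injEq, Fin.mk.injEq] at h
    obtain ⟨rfl, h⟩ := h
    simp only [residueGraph_adj, Fin.lt_def] at huv hu huv' hu'
    have div_pos {w : ℕ} (hw : s ≤ w) : 0 < w / s := Nat.div_pos hw hs
    have huu : u.1 = u'.1 := by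
      simp only [code] at h
      split_ifs at h with h1 h2 h2
      · exact h
      · have := div_pos (not_lt.1 h2)
        omega
      · have := div_pos (not_lt.1 h1)
        omega
      · have hdiv : u.1 / s = u'.1 / s := by omega
        have hmod : u.1 % s = u'.1 % s := by omega
        rw [← Nat.div_add_mod u.1 s, hdiv, hmod, Nat.div_add_mod]
    rw [Fin.ext huu]
  refine le_trans ?_ ((Set.ncard_image_le (f := fun p => s(p.1, p.2)) (s := P)).trans hP)
  refine Set.ncard_le_ncard fun e => ?_
  induction e with
  | _ u v =>
    rw [SimpleGraph.mem_edgeSet, SimpleGraph.compl_adj]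
    rintro ⟨hne, hadj⟩
    rcases lt_or_gt_of_ne hne with h | h
    · exact ⟨(u, v), ⟨h, hadj⟩, rfl⟩
    · exact ⟨(v, u), ⟨h, fun h' => hadj h'.symm⟩, Sym2.eq_swap⟩

theorem choose_two_le_edgeSet_ncard_add_compl {n : ℕ} (G : SimpleGraph (Fin n)) :
    n.choose 2 ≤ G.edgeSet.ncard + Gᶜ.edgeSet.ncard := by
  have htop : (⊤ : SimpleGraph (Fin n)).edgeSet.ncard = n.choose 2 := by
    rw [← SimpleGraph.coe_edgeFinset, Set.ncard_coe_finset,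
      SimpleGraph.card_edgeFinset_top_eq_card_choose_two, Fintype.card_fin]
  rw [← htop, ← sup_compl_eq_top (x := G), SimpleGraph.edgeSet_sup]
  exact Set.ncard_union_le _ _

/-- Upper bound on the gap-strength of `K_n`: for `n ≥ 4`, there is a connected
gap-vertex-labelable simple graph on `n` vertices missing at most `3 · n^{3/2}` of the
`C(n,2)` possible edges.  Equivalently, `str_gap (K_n) ≤ 3 · n^{3/2}`, so
`str_gap (K_n) ∈ O(n^{3/2})`. -/
theorem gapStrength_upper_bound (n : ℕ) (hn : 4 ≤ n) :
    ∃ G : SimpleGraph (Fin n), G.Connected ∧ GapVertexLabelable G ∧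
      ((n.choose 2 - G.edgeSet.ncard : ℕ) : ℝ) ≤ 3 * (n : ℝ) * Real.sqrt n := by
  have hs : 2 ≤ n.sqrt := Nat.le_sqrt.2 (by omega)
  have hsq : n.sqrt * n.sqrt ≤ n := Nat.sqrt_le n
  have hlt : n ≤ n.sqrt * (n.sqrt + 2) := by
    have := Nat.sqrt_le_add n
    linarith
  have h2 : 2 * n.sqrt ≤ n := (Nat.mul_le_mul_right _ hs).trans hsq
  refine ⟨residueGraph n n.sqrt, residueGraph_connected hs h2,
    residueGraph_gapVertexLabelable hs h2, ?_⟩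
  have hmissing : n.choose 2 - (residueGraph n n.sqrt).edgeSet.ncard ≤ n * (3 * n.sqrt) :=
    (Nat.sub_le_iff_le_add'.2 (choose_two_le_edgeSet_ncard_add_compl _)).trans <|
      (residueGraph_compl_edgeSet_ncard_le (by omega) hlt).trans
        (Nat.mul_le_mul_left _ (by omega))
  calc ((n.choose 2 - (residueGraph n n.sqrt).edgeSet.ncard : ℕ) : ℝ)
      ≤ ((n * (3 * n.sqrt) : ℕ) : ℝ) := Nat.cast_le.2 hmissing
    _ = 3 * (n : ℝ) * (n.sqrt : ℝ) := by push_cast; ring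
    _ ≤ 3 * (n : ℝ) * Real.sqrt n := by
      gcongr
      exact Real.nat_sqrt_le_real_sqrt
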